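/- Start the chain Ẑ from (0,0). Then Σ_{n=1}^∞ ℙ[A_n ∩ B_n] = +∞. -/

import Mathlib

open MeasureTheory
open scoped ENNReal

/-- Transition probabilities of the conditioned walk `Ẑ` on `ℕ × ℤ`
(the Doob h-transform, with harmonic function `h(x,y) = x + 1`, of the walk with i.i.d.
increments uniform on `{(1,-1), (-1,0), (0,1)}`). -/
noncomputable def transProb : ℕ × ℤ → ℕ × ℤ → ℝ := fun p q =>
  if q.1 = p.1 + 1 ∧ q.2 = p.2 - 1 then ((p.1 : ℝ) + 2) / (3 * ((p.1 : ℝ) + 1))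
  else if q.1 + 1 = p.1 ∧ q.2 = p.2 then (p.1 : ℝ) / (3 * ((p.1 : ℝ) + 1))
  else if q.1 = p.1 ∧ q.2 = p.2 + 1 then 1 / 3
  else 0

/-- The expectation of `f` after one step of the chain started from `p`. -/
noncomputable def stepMean (f : ℕ × ℤ → ℝ≥0∞) (p : ℕ × ℤ) : ℝ≥0∞ :=
  ENNReal.ofReal (((p.1 : ℝ) + 2) / (3 * ((p.1 : ℝ) + 1))) * f (p.1 + 1, p.2 - 1) +
    ENNReal.ofReal ((p.1 : ℝ) / (3 * ((p.1 : ℝ) + 1))) * f (p.1 - 1, p.2) +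
    ENNReal.ofReal (1 / 3) * f (p.1, p.2 + 1)

lemma transProb_nonneg (p q : ℕ × ℤ) : 0 ≤ transProb p q := by
  unfold transProb
  split_ifs <;> positivity

lemma tsum_transProb_mul (f : ℕ × ℤ → ℝ≥0∞) (p : ℕ × ℤ) :
    ∑' q, ENNReal.ofReal (transProb p q) * f q = stepMean f p := by
  obtain ⟨x, y⟩ := p
  rw [tsum_eq_sum (s := {(x + 1, y - 1), (x - 1, y), (x, y + 1)})]
  · rw [Finset.sum_insert (by simp), Finset.sum_insert (by simp), Finset.sum_singleton, stepMean,
      ← add_assoc]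
    congr 2
    · simp [transProb]
    · rcases x with _ | x
      · simp [transProb]
      · congr 2
        simp only [transProb]
        rw [if_neg (by simp; omega), if_pos (by simp)]
    · simp [transProb]
  · rintro ⟨a, b⟩ h
    have : transProb (x, y) (a, b) = 0 := by
      simp only [Finset.mem_insert, Finset.mem_singleton, Prod.mk.injEq, not_or] at h
      unfold transProb
      rw [if_neg (by simpa using h.1), if_neg (by grind), if_neg (by simpa using h.2.2)]
    simp [this]

lemma ofReal_le_stepMean (g : ℕ × ℤ → ℝ) (p : ℕ × ℤ) :
    ENNReal.ofReal (((p.1 : ℝ) + 2) / (3 * ((p.1 : ℝ) + 1)) * g (p.1 + 1, p.2 - 1) +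
      (p.1 : ℝ) / (3 * ((p.1 : ℝ) + 1)) * g (p.1 - 1, p.2) + 1 / 3 * g (p.1, p.2 + 1)) ≤
      stepMean (fun q ↦ ENNReal.ofReal (g q)) p := by
  unfold stepMean
  rw [← ENNReal.ofReal_mul (by positivity), ← ENNReal.ofReal_mul (by positivity),
    ← ENNReal.ofReal_mul (by positivity)]
  exact ENNReal.ofReal_add_le.trans (by gcongr; exact ENNReal.ofReal_add_le)

/-- The function `1 - a / (x + 1)`, harmonic for the chain killed below `a`. -/
lemma escape_le_stepMean (a : ℕ) (p : ℕ × ℤ) (hp : a ≤ p.1) :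
    ENNReal.ofReal (1 - a / ((p.1 : ℝ) + 1)) ≤
      stepMean (fun q ↦ ENNReal.ofReal (1 - a / ((q.1 : ℝ) + 1))) p := by
  refine le_trans (ENNReal.ofReal_le_ofReal (le_of_eq ?_))
    (ofReal_le_stepMean (fun q ↦ 1 - a / ((q.1 : ℝ) + 1)) p)
  obtain ⟨x, y⟩ := p
  rcases x with _ | x
  · obtain rfl : a = 0 := by simpa using hp
    norm_num
  · simp only [Nat.add_sub_cancel]
    push_cast
    have : (x : ℝ) + 1 ≠ 0 := by positivity
    have : (x : ℝ) + 1 + 1 ≠ 0 := by positivity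
    have : (x : ℝ) + 1 + 1 + 1 ≠ 0 := by positivity
    have : (x : ℝ) + 1 + 2 = x + 1 + 1 + 1 := by ring
    rw [this]
    field_simp
    ring

/-- The function `2 / c - (x + 1 + 2 (y + K)) / c ^ 2` is harmonic for the chain. -/
lemma potential_le_stepMean (K : ℕ) (c : ℝ) (hc : 0 < c) (p : ℕ × ℤ) (hp : -(K : ℤ) < p.2) :
    ENNReal.ofReal (2 / c - ((p.1 : ℝ) + 1 + 2 * (p.2 + K)) / c ^ 2) ≤
      stepMean (fun q ↦ if -(K : ℤ) ≤ q.2 then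
        ENNReal.ofReal (2 / c - ((q.1 : ℝ) + 1 + 2 * (q.2 + K)) / c ^ 2) else 0) p := by
  refine le_trans (ENNReal.ofReal_le_ofReal (le_of_eq ?_))
    ((ofReal_le_stepMean (fun q ↦ 2 / c - ((q.1 : ℝ) + 1 + 2 * (q.2 + K)) / c ^ 2) p).trans
      (le_of_eq ?_))
  · obtain ⟨x, y⟩ := p
    rcases x with _ | x
    · push_cast
      field_simp
      ring
    · simp only [Nat.add_sub_cancel]
      push_cast
      have : (x : ℝ) + 1 + 1 ≠ 0 := by positivity
      field_simp
      ring
  · simp only [stepMean]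
    rw [if_pos (by omega), if_pos (by omega), if_pos (by omega)]

lemma stepMean_height_add (K : ℕ) (p : ℕ × ℤ) (hp : -(K : ℤ) < p.2) :
    stepMean (fun q ↦ ENNReal.ofReal ((q.2 : ℝ) + K)) p +
      ENNReal.ofReal (1 / 3) * ENNReal.ofReal (1 / ((p.1 : ℝ) + 1)) =
      ENNReal.ofReal ((p.2 : ℝ) + K) := by
  obtain ⟨x, y⟩ := p
  have h : (1 : ℝ) ≤ y + K := by
    have : (1 : ℤ) ≤ y + K := by simp only at hp; omega
    exact_mod_cast this
  simp only [stepMean]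
  push_cast
  have h1 : (0 : ℝ) ≤ y - 1 + K := by linarith
  have h2 : (0 : ℝ) ≤ y + K := by linarith
  have h3 : (0 : ℝ) ≤ y + 1 + K := by linarith
  rw [← ENNReal.ofReal_mul (by positivity), ← ENNReal.ofReal_mul (by positivity),
    ← ENNReal.ofReal_mul (by positivity), ← ENNReal.ofReal_mul (by positivity),
    ← ENNReal.ofReal_add (by positivity) (by positivity),
    ← ENNReal.ofReal_add (by positivity) (by positivity),
    ← ENNReal.ofReal_add (by positivity) (by positivity)]
  congr 1
  field_simp
  ring

/-- `Z` is the conditioned walk started from `(0, 0)`. -/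
def IsConditionedWalk {Ω : Type*} [MeasurableSpace Ω] (P : Measure Ω) (Z : ℕ → Ω → ℕ × ℤ) :
    Prop :=
  (∀ n, Measurable (Z n)) ∧ ∀ (n : ℕ) (p : ℕ → ℕ × ℤ), p 0 = (0, 0) →
    (P {ω | ∀ j ≤ n, Z j ω = p j}).toReal = ∏ j ∈ Finset.range n, transProb (p j) (p (j + 1))

/-- `E` is an event of the trajectory of `Z` up to time `n`. -/
def DependsOnPast {Ω : Type*} (Z : ℕ → Ω → ℕ × ℤ) (n : ℕ) (E : Set Ω) : Prop :=
  ∀ ω ω', (∀ j ≤ n, Z j ω = Z j ω') → ω ∈ E → ω' ∈ E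

section

variable {Ω : Type*} {Z : ℕ → Ω → ℕ × ℤ}

/-- The trajectories following `p` up to time `n`. -/
def pathCylinder (Z : ℕ → Ω → ℕ × ℤ) (n : ℕ) (p : ℕ → ℕ × ℤ) : Set Ω := {ω | ∀ j ≤ n, Z j ω = p j}

lemma DependsOnPast.eq_iUnion {n : ℕ} {E : Set Ω} (hE : DependsOnPast Z n E) :
    E = ⋃ h : {h : Fin (n + 1) → ℕ × ℤ //
        ∃ ω ∈ E, ∀ j : Fin (n + 1), Z j ω = h j},
      pathCylinder Z n (fun j ↦ h.1 (Fin.ofNat (n + 1) j)) := by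
  have key : ∀ j ≤ n, ((Fin.ofNat (n + 1) j : Fin (n + 1)) : ℕ) = j := fun j hj ↦ by
    simp [Fin.ofNat]; omega
  ext ω
  simp only [Set.mem_iUnion, pathCylinder, Set.mem_ofPred_eq]
  constructor
  · intro h
    refine ⟨⟨fun j ↦ Z j ω, ω, h, fun _ ↦ rfl⟩, fun j hj ↦ ?_⟩
    simp only [key j hj]
  · rintro ⟨⟨h, ω', hω', hh⟩, hω⟩
    refine hE ω' ω (fun j hj ↦ ?_) hω'
    have := hh (Fin.ofNat (n + 1) j)
    rw [key j hj] at this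
    exact this.trans (hω j hj).symm

lemma pathCylinder_disjoint (n : ℕ) (S : (Fin (n + 1) → ℕ × ℤ) → Prop) :
    Pairwise (Function.onFun Disjoint
      (fun h : {h // S h} ↦ pathCylinder Z n (fun j ↦ h.1 (Fin.ofNat (n + 1) j)))) := by
  intro h h' hne
  refine Set.disjoint_left.2 fun ω hω hω' ↦ hne (Subtype.ext (funext fun j ↦ ?_))
  have := (hω j (by omega)).symm.trans (hω' j (by omega))
  simpa using this

/-- The second coordinate has stayed above `-K` up to time `n`. -/
def aliveSet (Z : ℕ → Ω → ℕ × ℤ) (K n : ℕ) : Set Ω := {ω | ∀ j ≤ n, -(K : ℤ) < (Z j ω).2}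

/-- The second coordinate reaches `-K` for the first time at time `n`. -/
def hitSet (Z : ℕ → Ω → ℕ × ℤ) (K n : ℕ) : Set Ω :=
  {ω | (∀ j < n, -(K : ℤ) < (Z j ω).2) ∧ (Z n ω).2 = -(K : ℤ)}

lemma dependsOnPast_aliveSet (K n : ℕ) : DependsOnPast Z n (aliveSet Z K n) :=
  fun _ _ h hω j hj ↦ h j hj ▸ hω j hj

lemma dependsOnPast_hitSet (K n : ℕ) : DependsOnPast Z n (hitSet Z K n) :=
  fun _ _ h hω ↦ ⟨fun j hj ↦ h j hj.le ▸ hω.1 j hj, h n le_rfl ▸ hω.2⟩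

variable [MeasurableSpace Ω] {P : Measure Ω}

lemma measurableSet_pathCylinder (hZ : ∀ n, Measurable (Z n)) (n : ℕ) (p : ℕ → ℕ × ℤ) :
    MeasurableSet (pathCylinder Z n p) := by
  have : pathCylinder Z n p = ⋂ j, ⋂ (_ : j ≤ n), Z j ⁻¹' {p j} := by
    ext; simp [pathCylinder]
  rw [this]
  exact .iInter fun j ↦ .iInter fun _ ↦ hZ j (measurableSet_singleton _)

lemma DependsOnPast.measurableSet {n : ℕ} {E : Set Ω} (hE : DependsOnPast Z n E)
    (hZ : ∀ n, Measurable (Z n)) : MeasurableSet E := by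
  rw [hE.eq_iUnion]
  exact .iUnion fun h ↦ measurableSet_pathCylinder hZ _ _

lemma measure_pathCylinder_inter [IsProbabilityMeasure P] (hZ : IsConditionedWalk P Z) (n : ℕ)
    (p : ℕ → ℕ × ℤ) (q : ℕ × ℤ) :
    P (pathCylinder Z n p ∩ Z (n + 1) ⁻¹' {q}) =
      P (pathCylinder Z n p) * ENNReal.ofReal (transProb (p n) q) := by
  by_cases h0 : p 0 = (0, 0)
  · let p' : ℕ → ℕ × ℤ := fun j ↦ if j ≤ n then p j else q
    have hset : pathCylinder Z n p ∩ Z (n + 1) ⁻¹' {q} = {ω | ∀ j ≤ n + 1, Z j ω = p' j} := by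
      ext ω
      simp only [pathCylinder, Set.mem_inter_iff, Set.mem_ofPred_eq, Set.mem_preimage,
        Set.mem_singleton_iff, p']
      constructor
      · rintro ⟨h, h'⟩ j hj
        split_ifs with hjn
        · exact h j hjn
        · obtain rfl : j = n + 1 := by omega
          exact h'
      · intro h
        refine ⟨fun j hj ↦ ?_, ?_⟩
        · simpa [hj] using h j (by omega)
        · simpa using h (n + 1) le_rfl
    have h1 := hZ.2 (n + 1) p' (by simpa [p'] using h0)
    have h2 := hZ.2 n p h0
    rw [← ENNReal.toReal_eq_toReal_iff' (measure_ne_top _ _)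
      (ENNReal.mul_ne_top (measure_ne_top _ _) ENNReal.ofReal_ne_top), ENNReal.toReal_mul,
      ENNReal.toReal_ofReal (transProb_nonneg _ _), hset, h1, pathCylinder, h2,
      Finset.prod_range_succ]
    congr 1
    · refine Finset.prod_congr rfl fun j hj ↦ ?_
      rw [Finset.mem_range] at hj
      simp [p', hj.le, Nat.succ_le_of_lt hj]
    · simp [p']
  · have hstart : P {ω | ∀ j ≤ 0, Z j ω = (0, 0)} = 1 := by
      have := hZ.2 0 (fun _ ↦ (0, 0)) rfl
      rw [Finset.range_zero, Finset.prod_empty] at this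
      exact (ENNReal.toReal_eq_one_iff _).1 this
    have hnull : P (pathCylinder Z n p) = 0 := by
      have hm : MeasurableSet {ω | ∀ j ≤ 0, Z j ω = (0, 0)} :=
        measurableSet_pathCylinder hZ.1 0 (fun _ ↦ (0, 0))
      refine measure_mono_null ?_ ((prob_compl_eq_zero_iff hm).2 hstart)
      intro ω hω hω'
      exact h0 ((hω 0 (Nat.zero_le _)).symm.trans (hω' 0 le_rfl))
    rw [hnull, zero_mul]
    exact measure_mono_null Set.inter_subset_left hnull

/-- The Markov property. -/
lemma setLIntegral_succ [IsProbabilityMeasure P] (hZ : IsConditionedWalk P Z) {n : ℕ}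
    {E : Set Ω} (hE : DependsOnPast Z n E) (f : ℕ × ℤ → ℝ≥0∞) :
    ∫⁻ ω in E, f (Z (n + 1) ω) ∂P = ∫⁻ ω in E, stepMean f (Z n ω) ∂P := by
  rw [hE.eq_iUnion, lintegral_iUnion (fun h ↦ measurableSet_pathCylinder hZ.1 _ _)
    (pathCylinder_disjoint n _), lintegral_iUnion (fun h ↦ measurableSet_pathCylinder hZ.1 _ _)
    (pathCylinder_disjoint n _)]
  refine tsum_congr fun h ↦ ?_
  generalize (fun j ↦ h.1 (Fin.ofNat (n + 1) j)) = p
  have hm := measurableSet_pathCylinder hZ.1 n p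
  have hr : ∫⁻ ω in pathCylinder Z n p, stepMean f (Z n ω) ∂P =
      stepMean f (p n) * P (pathCylinder Z n p) := by
    rw [setLIntegral_congr_fun hm (g := fun _ ↦ stepMean f (p n))
      (fun ω hω ↦ by simp only [hω n le_rfl]), setLIntegral_const]
  rw [hr, ← lintegral_map (μ := P.restrict (pathCylinder Z n p)) (f := f)
    (Measurable.of_discrete) (hZ.1 (n + 1)), lintegral_countable', ← tsum_transProb_mul,
    ← ENNReal.tsum_mul_right]
  refine tsum_congr fun q ↦ ?_
  rw [Measure.map_apply (hZ.1 _) (measurableSet_singleton _),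
    Measure.restrict_apply (hZ.1 _ (measurableSet_singleton _)), Set.inter_comm,
    measure_pathCylinder_inter hZ]
  ring

/-- From height `a`, the chain stays at height at least `a` forever with probability at least
`1 / (a + 1)`, conditionally on the past. -/
lemma le_measure_inter_stays_of_height [IsProbabilityMeasure P] (hZ : IsConditionedWalk P Z)
    {n : ℕ} {E : Set Ω} (hE : DependsOnPast Z n E) (a : ℕ) (hEa : ∀ ω ∈ E, (Z n ω).1 = a) :
    ∫⁻ ω in E, ENNReal.ofReal (1 / (((Z n ω).1 : ℝ) + 1)) ∂P ≤
      P (E ∩ {ω | ∀ j, n ≤ j → (Z n ω).1 ≤ (Z j ω).1}) := by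
  let S : ℕ → Set Ω := fun m ↦ {ω | ω ∈ E ∧ ∀ j, n ≤ j → j ≤ n + m → a ≤ (Z j ω).1}
  have hS : ∀ m, DependsOnPast Z (n + m) (S m) := fun m ω ω' h hω ↦
    ⟨hE ω ω' (fun j hj ↦ h j (by omega)) hω.1, fun j hj hj' ↦ h j hj' ▸ hω.2 j hj hj'⟩
  let g : ℕ × ℤ → ℝ≥0∞ := fun q ↦ ENNReal.ofReal (1 - a / ((q.1 : ℝ) + 1))
  have hg0 : ∀ q : ℕ × ℤ, q.1 < a → g q = 0 := fun q hq ↦ by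
    refine ENNReal.ofReal_of_nonpos ?_
    rw [sub_nonpos, le_div_iff₀ (by positivity)]
    have : (q.1 : ℝ) + 1 ≤ a := by exact_mod_cast hq
    linarith
  have hsucc : ∀ m, ∫⁻ ω in S m, g (Z (n + m) ω) ∂P ≤
      ∫⁻ ω in S (m + 1), g (Z (n + (m + 1)) ω) ∂P := fun m ↦ by
    have hm := (hS m).measurableSet hZ.1
    have hm' := (hS (m + 1)).measurableSet hZ.1
    calc ∫⁻ ω in S m, g (Z (n + m) ω) ∂P
        ≤ ∫⁻ ω in S m, stepMean g (Z (n + m) ω) ∂P :=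
          setLIntegral_mono' hm fun ω hω ↦
            escape_le_stepMean a _ (hω.2 (n + m) (by omega) le_rfl)
      _ = ∫⁻ ω in S m, g (Z (n + (m + 1)) ω) ∂P := (setLIntegral_succ hZ (hS m) g).symm
      _ ≤ ∫⁻ ω in S (m + 1), g (Z (n + (m + 1)) ω) ∂P := by
          rw [← lintegral_indicator hm, ← lintegral_indicator hm']
          refine lintegral_mono fun ω ↦ ?_
          by_cases h : ω ∈ S m
          · by_cases h' : ω ∈ S (m + 1)
            · simp [h, h']
            · rw [Set.indicator_of_mem h, Set.indicator_of_notMem h', hg0]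
              by_contra! hlt
              refine h' ⟨h.1, fun j hj hj' ↦ ?_⟩
              rcases Nat.lt_or_ge (n + m) j with hj2 | hj2
              · obtain rfl : j = n + (m + 1) := by omega
                exact hlt
              · exact h.2 j hj hj2
          · simp [h]
  have hS0 : S 0 = E := by
    ext ω
    refine ⟨fun h ↦ h.1, fun h ↦ ⟨h, fun j hj hj' ↦ ?_⟩⟩
    obtain rfl : j = n := by omega
    exact (hEa ω h).ge
  have hbase : ∫⁻ ω in E, ENNReal.ofReal (1 / (((Z n ω).1 : ℝ) + 1)) ∂P =
      ∫⁻ ω in S 0, g (Z (n + 0) ω) ∂P := by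
    rw [hS0]
    refine setLIntegral_congr_fun (hE.measurableSet hZ.1) fun ω hω ↦ ?_
    simp only [g, hEa ω hω, add_zero]
    congr 1
    field_simp
    ring
  have hle : ∀ m, ∫⁻ ω in E, ENNReal.ofReal (1 / (((Z n ω).1 : ℝ) + 1)) ∂P ≤ P (S m) := fun m ↦ by
    rw [hbase]
    refine (monotone_nat_of_le_succ (f := fun m ↦ ∫⁻ ω in S m, g (Z (n + m) ω) ∂P) hsucc
      (Nat.zero_le m)).trans ?_
    rw [← setLIntegral_one]
    refine lintegral_mono fun ω ↦ ENNReal.ofReal_le_one.2 ?_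
    have : (0 : ℝ) ≤ a / (((Z (n + m) ω).1 : ℝ) + 1) := by positivity
    linarith
  have hanti : Antitone S := fun m m' hmm ω hω ↦ ⟨hω.1, fun j hj hj' ↦ hω.2 j hj (by omega)⟩
  have hinter : E ∩ {ω | ∀ j, n ≤ j → (Z n ω).1 ≤ (Z j ω).1} = ⋂ m, S m := by
    ext ω
    simp only [Set.mem_inter_iff, Set.mem_ofPred_eq, Set.mem_iInter]
    constructor
    · rintro ⟨h, h'⟩ m
      exact ⟨h, fun j hj _ ↦ hEa ω h ▸ h' j hj⟩
    · intro h
      exact ⟨(h 0).1, fun j hj ↦ (hEa ω (h 0).1).symm ▸ (h j).2 j hj (by omega)⟩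
  rw [hinter, hanti.measure_iInter (fun m ↦ ((hS m).measurableSet hZ.1).nullMeasurableSet)
    ⟨0, measure_ne_top _ _⟩]
  exact le_iInf hle

lemma le_measure_inter_stays [IsProbabilityMeasure P] (hZ : IsConditionedWalk P Z)
    {n : ℕ} {E : Set Ω} (hE : DependsOnPast Z n E) :
    ∫⁻ ω in E, ENNReal.ofReal (1 / (((Z n ω).1 : ℝ) + 1)) ∂P ≤
      P (E ∩ {ω | ∀ j, n ≤ j → (Z n ω).1 ≤ (Z j ω).1}) := by
  let F : ℕ → Set Ω := fun a ↦ {ω | ω ∈ E ∧ (Z n ω).1 = a}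
  have hF : ∀ a, DependsOnPast Z n (F a) := fun a ω ω' h hω ↦
    ⟨hE ω ω' h hω.1, h n le_rfl ▸ hω.2⟩
  have hFm : ∀ a, MeasurableSet (F a) := fun a ↦ (hF a).measurableSet hZ.1
  have hdisj : Pairwise (Function.onFun Disjoint F) := fun a b hab ↦
    Set.disjoint_left.2 fun ω h h' ↦ hab (h.2.symm.trans h'.2)
  have hB : MeasurableSet {ω | ∀ j, n ≤ j → (Z n ω).1 ≤ (Z j ω).1} := by
    have : {ω | ∀ j, n ≤ j → (Z n ω).1 ≤ (Z j ω).1} =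
        ⋂ j, ⋂ (_ : n ≤ j), {ω | (Z n ω).1 ≤ (Z j ω).1} := by
      ext; simp
    rw [this]
    exact .iInter fun j ↦ .iInter fun _ ↦
      measurableSet_le (measurable_fst.comp (hZ.1 n)) (measurable_fst.comp (hZ.1 j))
  have hU : E = ⋃ a, F a := by
    ext ω
    simp [F]
  conv_lhs => rw [hU, lintegral_iUnion hFm hdisj]
  conv_rhs => rw [hU, Set.iUnion_inter]
  rw [measure_iUnion (fun a b hab ↦ (hdisj hab).mono Set.inter_subset_left Set.inter_subset_left)
    (fun a ↦ (hFm a).inter hB)]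
  exact ENNReal.tsum_le_tsum fun a ↦
    le_measure_inter_stays_of_height hZ (hF a) a fun ω hω ↦ hω.2

lemma ae_start [IsProbabilityMeasure P] (hZ : IsConditionedWalk P Z) :
    ∀ᵐ ω ∂P, Z 0 ω = (0, 0) := by
  have h := hZ.2 0 (fun _ ↦ (0, 0)) rfl
  rw [Finset.range_zero, Finset.prod_empty] at h
  have hm : MeasurableSet {ω | ∀ j ≤ 0, Z j ω = (0, 0)} :=
    measurableSet_pathCylinder hZ.1 0 (fun _ ↦ (0, 0))
  have h1 := (prob_compl_eq_zero_iff hm).2 ((ENNReal.toReal_eq_one_iff _).1 h)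
  filter_upwards [measure_eq_zero_iff_ae_notMem.1 h1] with ω hω
  simpa using hω

lemma setLIntegral_aliveSet_zero [IsProbabilityMeasure P] (hZ : IsConditionedWalk P Z) (K : ℕ)
    (hK : 0 < K) (f : ℕ × ℤ → ℝ≥0∞) : ∫⁻ ω in aliveSet Z K 0, f (Z 0 ω) ∂P = f (0, 0) := by
  have h : ∀ᵐ ω ∂P, ω ∈ aliveSet Z K 0 := by
    filter_upwards [ae_start hZ] with ω hω j hj
    obtain rfl : j = 0 := by omega
    rw [hω]
    simpa using hK
  rw [Measure.restrict_eq_self_of_ae_mem h, lintegral_congr_ae (g := fun _ ↦ f (0, 0))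
    (by filter_upwards [ae_start hZ] with ω hω; rw [hω])]
  simp

lemma sum_alive_le [IsProbabilityMeasure P] (hZ : IsConditionedWalk P Z) (K : ℕ) (hK : 0 < K) :
    ∑' n, ∫⁻ ω in aliveSet Z K n, ENNReal.ofReal (1 / (((Z n ω).1 : ℝ) + 1)) ∂P ≠ ⊤ := by
  set D : ℕ → ℝ≥0∞ := fun n ↦
    ∫⁻ ω in aliveSet Z K n, ENNReal.ofReal (1 / (((Z n ω).1 : ℝ) + 1)) ∂P with hD
  let f : ℕ × ℤ → ℝ≥0∞ := fun q ↦ ENNReal.ofReal ((q.2 : ℝ) + K)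
  let Y : ℕ → ℝ≥0∞ := fun n ↦ ∫⁻ ω in aliveSet Z K n, f (Z n ω) ∂P
  have hstep : ∀ n, Y (n + 1) + ENNReal.ofReal (1 / 3) * D n ≤ Y n := fun n ↦ by
    have hd := dependsOnPast_aliveSet (Z := Z) K n
    have hsub : aliveSet Z K (n + 1) ⊆ aliveSet Z K n := fun ω hω j hj ↦ hω j (by omega)
    calc Y (n + 1) + ENNReal.ofReal (1 / 3) * D n
        ≤ ∫⁻ ω in aliveSet Z K n, f (Z (n + 1) ω) ∂P + ENNReal.ofReal (1 / 3) * D n := by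
          gcongr
          exact lintegral_mono_set hsub
      _ = ∫⁻ ω in aliveSet Z K n, (stepMean f (Z n ω) + ENNReal.ofReal (1 / 3) *
            ENNReal.ofReal (1 / (((Z n ω).1 : ℝ) + 1))) ∂P := by
          rw [setLIntegral_succ hZ hd, lintegral_add_left, lintegral_const_mul]
          · exact (Measurable.of_discrete
              (f := fun p : ℕ × ℤ ↦ ENNReal.ofReal (1 / ((p.1 : ℝ) + 1)))).comp (hZ.1 n)
          · exact (Measurable.of_discrete (f := stepMean f)).comp (hZ.1 n)
      _ = Y n := setLIntegral_congr_fun (hd.measurableSet hZ.1) fun ω hω ↦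
          stepMean_height_add K _ (hω n le_rfl)
  have hsum : ∀ N, Y N + ENNReal.ofReal (1 / 3) * ∑ n ∈ Finset.range N, D n ≤ Y 0 := fun N ↦ by
    induction N with
    | zero => simp
    | succ N ih =>
      rw [Finset.sum_range_succ, mul_add, add_comm (_ * ∑ n ∈ _, _), ← add_assoc]
      exact (add_le_add_left (hstep N) _).trans ih
  have hlim : ENNReal.ofReal (1 / 3) * ∑' n, D n ≤ Y 0 := by
    rw [ENNReal.tsum_eq_iSup_nat, ENNReal.mul_iSup]
    exact iSup_le fun N ↦ le_add_self.trans (hsum N)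
  have hY : Y 0 ≠ ⊤ := by
    rw [show Y 0 = f (0, 0) from setLIntegral_aliveSet_zero hZ K hK f]
    exact ENNReal.ofReal_ne_top
  intro h
  rw [h, ENNReal.mul_top (by simp)] at hlim
  exact hY (top_le_iff.1 hlim)

lemma le_sum_hit [IsProbabilityMeasure P] (hZ : IsConditionedWalk P Z) (K : ℕ) (hK : 0 < K) :
    ENNReal.ofReal (1 / (1 + 2 * K)) ≤
      ∑' n, ∫⁻ ω in hitSet Z K (n + 1), ENNReal.ofReal (1 / (((Z (n + 1) ω).1 : ℝ) + 1)) ∂P := by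
  set c : ℝ := 1 + 2 * K with hcdef
  have hc : 0 < c := by positivity
  let f : ℕ × ℤ → ℝ≥0∞ := fun q ↦ ENNReal.ofReal (1 / ((q.1 : ℝ) + 1))
  let ψ : ℕ × ℤ → ℝ≥0∞ := fun q ↦
    ENNReal.ofReal (2 / c - ((q.1 : ℝ) + 1 + 2 * (q.2 + K)) / c ^ 2)
  let χ : ℕ × ℤ → ℝ≥0∞ := fun q ↦ if -(K : ℤ) ≤ q.2 then ψ q else 0
  let D : ℕ → ℝ≥0∞ := fun n ↦ ∫⁻ ω in aliveSet Z K n, f (Z n ω) ∂P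
  let H : ℕ → ℝ≥0∞ := fun n ↦ ∫⁻ ω in hitSet Z K (n + 1), f (Z (n + 1) ω) ∂P
  let Y : ℕ → ℝ≥0∞ := fun n ↦ ∫⁻ ω in aliveSet Z K n, ψ (Z n ω) ∂P
  have hψf : ∀ q : ℕ × ℤ, -(K : ℤ) ≤ q.2 → ψ q ≤ f q := fun q hq ↦ by
    refine ENNReal.ofReal_le_ofReal ?_
    have hy : (0 : ℝ) ≤ q.2 + K := by
      have : (0 : ℤ) ≤ q.2 + K := by omega
      exact_mod_cast this
    have hx : (0 : ℝ) < (q.1 : ℝ) + 1 := by positivity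
    have h1 : ((q.1 : ℝ) + 1) / c ^ 2 ≤ ((q.1 : ℝ) + 1 + 2 * (q.2 + K)) / c ^ 2 := by
      exact div_le_div_of_nonneg_right (by linarith) (by positivity)
    have h2 : 1 / ((q.1 : ℝ) + 1) - (2 / c - ((q.1 : ℝ) + 1) / c ^ 2) =
        (((q.1 : ℝ) + 1) - c) ^ 2 / (((q.1 : ℝ) + 1) * c ^ 2) := by
      field_simp
      ring
    have h3 : 0 ≤ (((q.1 : ℝ) + 1) - c) ^ 2 / (((q.1 : ℝ) + 1) * c ^ 2) := by positivity
    linarith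
  have hstep : ∀ n, Y n ≤ Y (n + 1) + H n := fun n ↦ by
    have hd := dependsOnPast_aliveSet (Z := Z) K n
    have hm := hd.measurableSet hZ.1
    have hm' := (dependsOnPast_aliveSet (Z := Z) K (n + 1)).measurableSet hZ.1
    have hh := (dependsOnPast_hitSet (Z := Z) K (n + 1)).measurableSet hZ.1
    have hψm : Measurable ((aliveSet Z K (n + 1)).indicator fun ω ↦ ψ (Z (n + 1) ω)) :=
      ((Measurable.of_discrete (f := ψ)).comp (hZ.1 (n + 1))).indicator hm'
    calc Y n ≤ ∫⁻ ω in aliveSet Z K n, stepMean χ (Z n ω) ∂P :=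
          setLIntegral_mono' hm fun ω hω ↦ potential_le_stepMean K c hc _ (hω n le_rfl)
      _ = ∫⁻ ω in aliveSet Z K n, χ (Z (n + 1) ω) ∂P := (setLIntegral_succ hZ hd χ).symm
      _ ≤ Y (n + 1) + H n := by
          simp only [Y, H]
          rw [← lintegral_indicator hm, ← lintegral_indicator hm', ← lintegral_indicator hh,
            ← lintegral_add_left hψm]
          refine lintegral_mono fun ω ↦ ?_
          by_cases h : ω ∈ aliveSet Z K n
          · rw [Set.indicator_of_mem h]
            rcases lt_trichotomy (-(K : ℤ)) (Z (n + 1) ω).2 with hlt | heq | hgt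
            · have h' : ω ∈ aliveSet Z K (n + 1) := fun j hj ↦ by
                rcases Nat.lt_or_ge n j with hj2 | hj2
                · obtain rfl : j = n + 1 := by omega
                  exact hlt
                · exact h j hj2
              simp only [χ, if_pos hlt.le, Set.indicator_of_mem h']
              exact le_self_add
            · have h' : ω ∈ hitSet Z K (n + 1) := ⟨fun j hj ↦ h j (by omega), heq.symm⟩
              simp only [χ, if_pos heq.le]
              rw [Set.indicator_of_mem h']
              exact (hψf _ heq.le).trans le_add_self
            · simp only [χ, if_neg hgt.not_ge]
              exact zero_le
          · simp [h]
  have hsum : ∀ N, Y 0 ≤ Y N + ∑ n ∈ Finset.range N, H n := fun N ↦ by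
    induction N with
    | zero => simp
    | succ N ih =>
      rw [Finset.sum_range_succ, add_comm (∑ n ∈ _, _), ← add_assoc]
      exact ih.trans (add_le_add_left (hstep N) _)
  have hYD : ∀ N, Y N ≤ D N := fun N ↦
    setLIntegral_mono' ((dependsOnPast_aliveSet (Z := Z) K N).measurableSet hZ.1)
      fun ω hω ↦ hψf _ (hω N le_rfl).le
  have hY0 : Y 0 = ENNReal.ofReal (1 / c) := by
    rw [show Y 0 = ψ (0, 0) from setLIntegral_aliveSet_zero hZ K hK ψ]
    simp only [ψ]
    congr 1
    push_cast
    field_simp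
    rw [hcdef]
    ring
  have hlim : Filter.Tendsto (fun N ↦ D N + ∑' n, H n) Filter.atTop (nhds (0 + ∑' n, H n)) :=
    (ENNReal.tendsto_atTop_zero_of_tsum_ne_top (sum_alive_le hZ K hK)).add tendsto_const_nhds
  rw [zero_add] at hlim
  refine ge_of_tendsto' hlim fun N ↦ ?_
  rw [← hY0]
  exact (hsum N).trans (add_le_add (hYD N) (ENNReal.sum_le_tsum _))

end

lemma tsum_ofReal_one_div_odd : ∑' K : ℕ, ENNReal.ofReal (1 / (1 + 2 * ((K + 1 : ℕ) : ℝ))) = ⊤ := by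
  by_contra h
  have hs := ENNReal.summable_toReal h
  have : Summable fun K : ℕ ↦ 1 / ((K + 1 : ℕ) : ℝ) := by
    refine Summable.of_nonneg_of_le (fun K ↦ by positivity) (fun K ↦ ?_) (hs.mul_left 3)
    rw [ENNReal.toReal_ofReal (by positivity), mul_one_div, div_le_div_iff₀ (by positivity)
      (by positivity)]
    push_cast
    have : (0 : ℝ) ≤ K := by positivity
    linarith
  exact Real.not_summable_one_div_natCast ((summable_nat_add_iff 1).1 this)

/-- Start the chain `Ẑ = (L̂, R̂)` from `(0,0)`.  With
`A n = {R̂ n ≤ R̂ j - 1 for all 0 ≤ j ≤ n-1}` and `B n = {L̂ j ≥ L̂ n for all j ≥ n}`,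
one has `Σ_{n ≥ 1} ℙ[A n ∩ B n] = ∞`. -/
theorem stmt_4
    {Ω : Type*} [MeasurableSpace Ω] (P : Measure Ω) [IsProbabilityMeasure P]
    (Zhat : ℕ → Ω → ℕ × ℤ)
    (hMeas : ∀ n, Measurable (Zhat n))
    (hPath : ∀ (n : ℕ) (p : ℕ → ℕ × ℤ), p 0 = (0, 0) →
      (P {ω | ∀ j ≤ n, Zhat j ω = p j}).toReal =
        ∏ j ∈ Finset.range n, transProb (p j) (p (j + 1))) :
    (∑' n : ℕ,
      P ({ω | ∀ j < n + 1, (Zhat (n + 1) ω).2 ≤ (Zhat j ω).2 - 1} ∩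
         {ω | ∀ j : ℕ, n + 1 ≤ j → (Zhat (n + 1) ω).1 ≤ (Zhat j ω).1})) = ⊤ := by
  have hZ : IsConditionedWalk P Zhat := ⟨hMeas, hPath⟩
  rw [← top_le_iff]
  calc ⊤ = ∑' K : ℕ, ENNReal.ofReal (1 / (1 + 2 * ((K + 1 : ℕ) : ℝ))) :=
        tsum_ofReal_one_div_odd.symm
    _ ≤ ∑' K : ℕ, ∑' n, ∫⁻ ω in hitSet Zhat (K + 1) (n + 1),
          ENNReal.ofReal (1 / (((Zhat (n + 1) ω).1 : ℝ) + 1)) ∂P :=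
        ENNReal.tsum_le_tsum fun K ↦ le_sum_hit hZ (K + 1) K.succ_pos
    _ = ∑' n, ∑' K : ℕ, ∫⁻ ω in hitSet Zhat (K + 1) (n + 1),
          ENNReal.ofReal (1 / (((Zhat (n + 1) ω).1 : ℝ) + 1)) ∂P := ENNReal.tsum_comm
    _ ≤ _ := ENNReal.tsum_le_tsum fun n ↦ ?_
  have hdisj : Pairwise (Function.onFun Disjoint fun K : ℕ ↦ hitSet Zhat (K + 1) (n + 1)) :=
    fun K K' hne ↦ Set.disjoint_left.2 fun ω h h' ↦ hne (by
      have := h.2.symm.trans h'.2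
      push_cast at this
      omega)
  have hd : ∀ m, DependsOnPast Zhat m (⋃ K : ℕ, hitSet Zhat (K + 1) m) := fun m ω ω' h hω ↦ by
    obtain ⟨K, hK⟩ := Set.mem_iUnion.1 hω
    exact Set.mem_iUnion.2 ⟨K, dependsOnPast_hitSet _ _ ω ω' h hK⟩
  rw [← lintegral_iUnion (fun K ↦ (dependsOnPast_hitSet _ _).measurableSet hMeas) hdisj]
  refine (le_measure_inter_stays hZ (hd (n + 1))).trans
    (measure_mono (Set.inter_subset_inter_left _ (Set.iUnion_subset fun K ω hω j hj ↦ ?_)))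
  have h1 := hω.1 j hj
  have h2 := hω.2
  omega
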